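/- Let P and Q be probability measures on a product Ω₁×Ω₂×Ω₃ of standard Borel spaces, both of which are Markov chains X→Y→Z, with P absolutely continuous with respect to Q and KL(P_{XY},Q_{XY}), KL(P_{YZ},Q_{YZ}), KL(P_Y,Q_Y) all finite. Then KL(P,Q) = KL(P_{XY},Q_{XY}) + KL(P_{YZ},Q_{YZ}) − KL(P_Y,Q_Y); in particular, KL(P,Q) ≤ KL(P_{XY},Q_{XY}) + KL(P_{YZ},Q_{YZ}), with equality if and only if P_Y = Q_Y. -/

import Mathlib

open MeasureTheory ProbabilityTheory Filter
open scoped ENNReal NNReal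

noncomputable section

universe u

/-- A finite measure on a product of three standard Borel spaces is a Markov chain
`X → Y → Z` if the third coordinate is conditionally independent of the first coordinate
given the second coordinate. -/
def IsMarkovChain {Ω₁ Ω₂ Ω₃ : Type*} [MeasurableSpace Ω₁] [MeasurableSpace Ω₂]
    [MeasurableSpace Ω₃] [StandardBorelSpace Ω₁] [StandardBorelSpace Ω₂]
    [StandardBorelSpace Ω₃] [Nonempty Ω₁] [Nonempty Ω₂] [Nonempty Ω₃]
    (P : Measure (Ω₁ × Ω₂ × Ω₃)) [IsFiniteMeasure P] : Prop :=
  CondIndepFun (MeasurableSpace.comap (fun ω : Ω₁ × Ω₂ × Ω₃ => ω.2.1) inferInstance)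
    (measurable_snd.fst.comap_le) (fun ω => ω.2.2) (fun ω => ω.1) P

open scoped Classical in
/-- The Kullback-Leibler divergence `KL(P,Q) = ∫ log (dP/dQ) dP` when `P ≪ Q` (and the
integral exists), and `+∞` otherwise. -/
def klDiv {Ω : Type*} [MeasurableSpace Ω] (P Q : Measure Ω) : ℝ≥0∞ :=
  if P ≪ Q ∧ Integrable (fun x => Real.log ((P.rnDeriv Q x).toReal)) P
  then ENNReal.ofReal (∫ x, Real.log ((P.rnDeriv Q x).toReal) ∂P)
  else ⊤

/-- For probability measures, `klDiv` agrees with Mathlib's `InformationTheory.klDiv`. -/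
lemma klDiv_eq_informationTheory_klDiv {Ω : Type*} [MeasurableSpace Ω] (P Q : Measure Ω)
    [IsProbabilityMeasure P] [IsProbabilityMeasure Q] :
    klDiv P Q = InformationTheory.klDiv P Q := by
  rw [klDiv, InformationTheory.klDiv_def]
  simp only [llr_def, probReal_univ, add_sub_cancel_right]
  congr

/-- The Kullback-Leibler divergence is invariant under measurable equivalences. -/
lemma informationTheory_klDiv_map_measurableEquiv {α β : Type*} [MeasurableSpace α]
    [MeasurableSpace β] (μ ν : Measure α) [IsFiniteMeasure μ] [IsFiniteMeasure ν] (e : α ≃ᵐ β) :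
    InformationTheory.klDiv (μ.map e) (ν.map e) = InformationTheory.klDiv μ ν := by
  refine le_antisymm (InformationTheory.klDiv_map_le μ ν e.measurable) ?_
  have h := InformationTheory.klDiv_map_le (μ.map e) (ν.map e) e.symm.measurable
  rwa [MeasurableEquiv.map_symm_map, MeasurableEquiv.map_symm_map] at h

/-- Two kernels that depend only on the first coordinate can be composed with a measure in
either order. -/
lemma map_compProd_prodMkRight_swap {α β γ : Type*} [MeasurableSpace α] [MeasurableSpace β]
    [MeasurableSpace γ] (μ : Measure α) [SFinite μ] (κ : Kernel α β) (η : Kernel α γ)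
    [IsSFiniteKernel κ] [IsSFiniteKernel η] :
    ((μ ⊗ₘ κ) ⊗ₘ η.prodMkRight β).map (fun p => ((p.1.1, p.2), p.1.2))
      = (μ ⊗ₘ η) ⊗ₘ κ.prodMkRight γ := by
  refine Measure.ext_of_lintegral _ fun f hf => ?_
  rw [lintegral_map hf (by fun_prop), Measure.lintegral_compProd (by fun_prop),
    Measure.lintegral_compProd (by fun_prop), Measure.lintegral_compProd (by fun_prop),
    Measure.lintegral_compProd (by fun_prop)]
  refine lintegral_congr fun a => ?_
  simp only [Kernel.prodMkRight_apply]
  exact lintegral_lintegral_swap (by fun_prop)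

/-- The measurable equivalence exchanging the last two coordinates of a triple. -/
def swapLastTwo (α β γ : Type*) [MeasurableSpace α] [MeasurableSpace β] [MeasurableSpace γ] :
    (α × β) × γ ≃ᵐ (α × γ) × β where
  toFun p := ((p.1.1, p.2), p.1.2)
  invFun p := ((p.1.1, p.2), p.1.2)
  left_inv _ := rfl
  right_inv _ := rfl
  measurable_toFun := by dsimp; fun_prop
  measurable_invFun := by dsimp; fun_prop

/-- Averaging the conditional divergence of two kernels that ignore a coordinate does not depend
on the law of that coordinate. -/
lemma informationTheory_klDiv_compProd_prodMkRight {α β γ : Type*} [MeasurableSpace α]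
    [MeasurableSpace β] [MeasurableSpace γ] (μ : Measure α) [IsFiniteMeasure μ] (ξ : Kernel α β)
    [IsMarkovKernel ξ] (κ η : Kernel α γ) [IsMarkovKernel κ] [IsMarkovKernel η] :
    InformationTheory.klDiv ((μ ⊗ₘ ξ) ⊗ₘ κ.prodMkRight β) ((μ ⊗ₘ ξ) ⊗ₘ η.prodMkRight β)
      = InformationTheory.klDiv (μ ⊗ₘ κ) (μ ⊗ₘ η) := by
  have h (κ : Kernel α γ) [IsMarkovKernel κ] :
      ((μ ⊗ₘ ξ) ⊗ₘ κ.prodMkRight β).map (swapLastTwo α β γ) = (μ ⊗ₘ κ) ⊗ₘ ξ.prodMkRight γ :=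
    map_compProd_prodMkRight_swap μ ξ κ
  rw [← informationTheory_klDiv_map_measurableEquiv _ _ (swapLastTwo α β γ), h, h,
    InformationTheory.klDiv_compProd_left]

section MarkovChain

variable {Ω₁ Ω₂ Ω₃ : Type*} [MeasurableSpace Ω₁] [MeasurableSpace Ω₂] [MeasurableSpace Ω₃]

/-- The measurable equivalence `(x, y, z) ↦ ((y, x), z)`. -/
def middleFirst (Ω₁ Ω₂ Ω₃ : Type*) [MeasurableSpace Ω₁] [MeasurableSpace Ω₂]
    [MeasurableSpace Ω₃] : Ω₁ × Ω₂ × Ω₃ ≃ᵐ (Ω₂ × Ω₁) × Ω₃ where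
  toFun ω := ((ω.2.1, ω.1), ω.2.2)
  invFun p := (p.1.2, p.1.1, p.2)
  left_inv _ := rfl
  right_inv _ := rfl
  measurable_toFun := by dsimp; fun_prop
  measurable_invFun := by dsimp; fun_prop

variable [StandardBorelSpace Ω₁] [StandardBorelSpace Ω₂] [StandardBorelSpace Ω₃]
  [Nonempty Ω₁] [Nonempty Ω₂] [Nonempty Ω₃]

/-- A Markov chain disintegrates into the law of `(Y, X)` and the conditional law of `Z` given
`Y`. -/
lemma IsMarkovChain.map_middleFirst {P : Measure (Ω₁ × Ω₂ × Ω₃)} [IsFiniteMeasure P]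
    (hP : IsMarkovChain P) :
    P.map (middleFirst Ω₁ Ω₂ Ω₃) = (P.map fun ω => (ω.2.1, ω.1))
      ⊗ₘ (condDistrib (fun ω => ω.2.2) (fun ω => ω.2.1) P).prodMkRight Ω₁ := by
  have h := (condIndepFun_iff_condDistrib_prod_ae_eq_prodMkRight (μ := P)
    (f := fun ω => ω.2.2) (g := fun ω => ω.1) (k := fun ω => ω.2.1) (by fun_prop) (by fun_prop)
    (by fun_prop)).1 (CondIndepFun.symm hP)
  exact (condDistrib_ae_eq_iff_measure_eq_compProd _ (by fun_prop) _).1 h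

/-- The divergence of two Markov chains and the divergence of their `(Y, Z)`-marginals exceed
those of the `(X, Y)`- and `Y`-marginals by the same conditional divergence. -/
lemma IsMarkovChain.exists_klDiv_eq_add {P Q : Measure (Ω₁ × Ω₂ × Ω₃)} [IsProbabilityMeasure P]
    [IsProbabilityMeasure Q] (hP : IsMarkovChain P) (hQ : IsMarkovChain Q) :
    ∃ r : ℝ≥0∞,
      klDiv P Q = klDiv (P.map fun ω => (ω.1, ω.2.1)) (Q.map fun ω => (ω.1, ω.2.1)) + r ∧
      klDiv (P.map fun ω => ω.2) (Q.map fun ω => ω.2)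
        = klDiv (P.map fun ω => ω.2.1) (Q.map fun ω => ω.2.1) + r := by
  have hXY (P : Measure (Ω₁ × Ω₂ × Ω₃)) [IsProbabilityMeasure P] :
      IsProbabilityMeasure (P.map fun ω => (ω.1, ω.2.1)) :=
    Measure.isProbabilityMeasure_map (by fun_prop)
  have hYX (P : Measure (Ω₁ × Ω₂ × Ω₃)) [IsProbabilityMeasure P] :
      IsProbabilityMeasure (P.map fun ω => (ω.2.1, ω.1)) :=
    Measure.isProbabilityMeasure_map (by fun_prop)
  have hYZ (P : Measure (Ω₁ × Ω₂ × Ω₃)) [IsProbabilityMeasure P] :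
      IsProbabilityMeasure (P.map fun ω => ω.2) :=
    Measure.isProbabilityMeasure_map (by fun_prop)
  have hY (P : Measure (Ω₁ × Ω₂ × Ω₃)) [IsProbabilityMeasure P] :
      IsProbabilityMeasure (P.map fun ω => ω.2.1) :=
    Measure.isProbabilityMeasure_map (by fun_prop)
  simp only [klDiv_eq_informationTheory_klDiv]
  set κ := condDistrib (fun ω : Ω₁ × Ω₂ × Ω₃ => ω.2.2) (fun ω => ω.2.1) P with hκ
  set η := condDistrib (fun ω : Ω₁ × Ω₂ × Ω₃ => ω.2.2) (fun ω => ω.2.1) Q with hη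
  refine ⟨InformationTheory.klDiv ((P.map fun ω => ω.2.1) ⊗ₘ κ) ((P.map fun ω => ω.2.1) ⊗ₘ η),
    ?_, ?_⟩
  · have hswap (P : Measure (Ω₁ × Ω₂ × Ω₃)) : P.map (fun ω => (ω.2.1, ω.1))
        = (P.map fun ω => (ω.1, ω.2.1)).map MeasurableEquiv.prodComm := by
      rw [Measure.map_map (by fun_prop) (by fun_prop)]
      rfl
    rw [← informationTheory_klDiv_map_measurableEquiv P Q (middleFirst Ω₁ Ω₂ Ω₃),
      hP.map_middleFirst, hQ.map_middleFirst, InformationTheory.klDiv_compProd_eq_add, ← hκ, ← hη]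
    congr 1
    · rw [hswap, hswap, informationTheory_klDiv_map_measurableEquiv]
    · rw [← compProd_map_condDistrib (μ := P) (X := fun ω => ω.2.1) (Y := fun ω => ω.1)
        (by fun_prop), informationTheory_klDiv_compProd_prodMkRight]
  · have h (P : Measure (Ω₁ × Ω₂ × Ω₃)) [IsProbabilityMeasure P] :
        (P.map fun ω => ω.2.1) ⊗ₘ condDistrib (fun ω => ω.2.2) (fun ω => ω.2.1) P
          = P.map fun ω => ω.2 :=
      compProd_map_condDistrib (by fun_prop)
    rw [← InformationTheory.klDiv_compProd_eq_add, h, h]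

end MarkovChain

/-- Chain rule / subadditivity of the KL divergence on three-variable Markov chains:
`KL(P,Q) = KL(P_XY,Q_XY) + KL(P_YZ,Q_YZ) - KL(P_Y,Q_Y)`; in particular
`KL(P,Q) ≤ KL(P_XY,Q_XY) + KL(P_YZ,Q_YZ)`, with equality iff `P_Y = Q_Y`. -/
theorem klDiv_markov_chain_rule
    (Ω₁ Ω₂ Ω₃ : Type u) [MeasurableSpace Ω₁] [MeasurableSpace Ω₂] [MeasurableSpace Ω₃]
    [StandardBorelSpace Ω₁] [StandardBorelSpace Ω₂] [StandardBorelSpace Ω₃]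
    [Nonempty Ω₁] [Nonempty Ω₂] [Nonempty Ω₃]
    (P Q : Measure (Ω₁ × Ω₂ × Ω₃)) [IsProbabilityMeasure P] [IsProbabilityMeasure Q]
    (hP : IsMarkovChain P) (hQ : IsMarkovChain Q) (hac : P ≪ Q)
    (hXY : klDiv (P.map fun ω => (ω.1, ω.2.1)) (Q.map fun ω => (ω.1, ω.2.1)) ≠ ⊤)
    (hYZ : klDiv (P.map fun ω => ω.2) (Q.map fun ω => ω.2) ≠ ⊤)
    (hY : klDiv (P.map fun ω => ω.2.1) (Q.map fun ω => ω.2.1) ≠ ⊤) :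
    klDiv P Q = klDiv (P.map fun ω => (ω.1, ω.2.1)) (Q.map fun ω => (ω.1, ω.2.1))
        + klDiv (P.map fun ω => ω.2) (Q.map fun ω => ω.2)
        - klDiv (P.map fun ω => ω.2.1) (Q.map fun ω => ω.2.1)
      ∧ klDiv P Q ≤ klDiv (P.map fun ω => (ω.1, ω.2.1)) (Q.map fun ω => (ω.1, ω.2.1))
        + klDiv (P.map fun ω => ω.2) (Q.map fun ω => ω.2)
      ∧ (klDiv P Q = klDiv (P.map fun ω => (ω.1, ω.2.1)) (Q.map fun ω => (ω.1, ω.2.1))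
            + klDiv (P.map fun ω => ω.2) (Q.map fun ω => ω.2)
          ↔ (P.map fun ω => ω.2.1) = (Q.map fun ω => ω.2.1)) := by
  have := Measure.isProbabilityMeasure_map (μ := P) (f := fun ω => ω.2.1) (by fun_prop)
  have := Measure.isProbabilityMeasure_map (μ := Q) (f := fun ω => ω.2.1) (by fun_prop)
  obtain ⟨r, hPQ, hr⟩ := hP.exists_klDiv_eq_add hQ
  have hr_top : r ≠ ⊤ := fun h => hYZ (by rw [hr, h, add_top])
  refine ⟨?_, ?_, ?_⟩
  · rw [hPQ, hr, add_left_comm, ENNReal.add_sub_cancel_left hY]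
  · rw [hPQ, hr]
    gcongr
    exact le_add_self
  · rw [hPQ, hr, ENNReal.add_right_inj hXY]
    nth_rw 1 [← zero_add r]
    rw [ENNReal.add_left_inj hr_top, eq_comm, klDiv_eq_informationTheory_klDiv,
      InformationTheory.klDiv_eq_zero_iff]
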